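/- Let g ≥ 2, let 1 ≤ k ≤ g−1, and let 0 ≤ i ≤ 4. Then for all τ₁ ∈ ℍ_k and τ₂ ∈ ℍ_{g−k}: P_{i,2^{4−i}}^g(diag(τ₁,τ₂)) = Σ_{n,m} N_{n,m;i}·P_{n,2^{4−n}}^k(τ₁)·P_{m,2^{4−m}}^{g−k}(τ₂), where the sum runs over all integers n, m with 0 ≤ n, m ≤ i ≤ n+m, where N_{n,m;i} := Π_{j=0}^{n+m−i−1} ((2^n − 2^j)(2^m − 2^j)/(2^{n+m−i} − 2^j)) (an empty product being 1), and diag(τ₁,τ₂) ∈ ℍ_g is the block-diagonal period matrix with blocks τ₁ and τ₂. -/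

import Mathlib

open scoped BigOperators

noncomputable section

/-- The Siegel upper half-space: symmetric complex matrices with positive
definite imaginary part (indexed by a finite type `ι`). -/
def Siegel (ι : Type) [Fintype ι] : Set (Matrix ι ι ℂ) :=
  {τ | τ.IsSymm ∧ ∀ v : ι → ℝ, v ≠ 0 → 0 < ∑ i, ∑ j, v i * (τ i j).im * v j}

/-- The theta function with characteristic `[ε, δ]`. -/
def theta {ι : Type} [Fintype ι] (ε δ : ι → ZMod 2) (τ : Matrix ι ι ℂ) (z : ι → ℂ) : ℂ :=
  ∑' n : ι → ℤ, Complex.exp ((Real.pi : ℂ) * Complex.I *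
    ((∑ i, ∑ j, ((n i : ℂ) + ((ε i).val : ℂ) / 2) * τ i j * ((n j : ℂ) + ((ε j).val : ℂ) / 2)) +
     2 * ∑ i, ((n i : ℂ) + ((ε i).val : ℂ) / 2) * (z i + ((δ i).val : ℂ) / 2)))

/-- A theta characteristic, an element of `𝔽₂^{2g}`. -/
abbrev Char2 (ι : Type) := (ι → ZMod 2) × (ι → ZMod 2)

/-- Theta function, with the characteristic as a pair. -/
def thetaChar {ι : Type} [Fintype ι] (m : Char2 ι) (τ : Matrix ι ι ℂ) (z : ι → ℂ) : ℂ :=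
  theta m.1 m.2 τ z

/-- Theta constant. -/
def thetaConst {ι : Type} [Fintype ι] (m : Char2 ι) (τ : Matrix ι ι ℂ) : ℂ :=
  thetaChar m τ 0

/-- `W` is (the underlying finite set of) an `i`-dimensional linear subspace of `𝔽₂^{2g}`. -/
def IsLinearSubspaceDim {ι : Type} [Fintype ι] (i : ℕ) (W : Finset (Char2 ι)) : Prop :=
  ∃ V : Submodule (ZMod 2) (Char2 ι),
    Module.finrank (ZMod 2) V = i ∧ (W : Set (Char2 ι)) = (V : Set (Char2 ι))

/-- The modular form `P_{i,s}^g(τ) = Σ_V (Π_{v∈V} θ_v(τ))^s`, the sum over all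
`i`-dimensional linear subspaces `V` of `𝔽₂^{2g}`. -/
noncomputable def Pform (ι : Type) [Fintype ι] (i s : ℕ) (τ : Matrix ι ι ℂ) : ℂ :=
  letI := Classical.propDecidable
  ∑ W ∈ Finset.univ.filter (fun W : Finset (Char2 ι) => IsLinearSubspaceDim i W),
    (∏ w ∈ W, thetaConst w τ) ^ s

/-- The combinatorial coefficient `N_{n,m;i}` appearing in the factorization of `P_{i,s}^g`. -/
def Ncoeff (n m i : ℕ) : ℚ :=
  ∏ j ∈ Finset.range (n + m - i),
    ((2 ^ n - 2 ^ j) * (2 ^ m - 2 ^ j) / (2 ^ (n + m - i) - 2 ^ j) : ℚ)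

/-- A product of nonnegative summable functions of the separate coordinates is summable. -/
theorem summable_prod_fin_apply {d : ℕ} (f : Fin d → ℤ → ℝ) (hf : ∀ i n, 0 ≤ f i n)
    (hs : ∀ i, Summable (f i)) : Summable fun n : Fin d → ℤ => ∏ i, f i (n i) := by
  induction d with
  | zero => exact Summable.of_finite
  | succ d ih =>
    have h := (hs 0).mul_of_nonneg (ih (fun i => f i.succ) (fun i => hf _) fun i => hs _)
      (hf 0) (fun n => Finset.prod_nonneg fun i _ => hf _ _)
    rw [← (Fin.consEquiv fun _ : Fin (d + 1) => ℤ).summable_iff]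
    refine h.congr fun p => ?_
    simp [Fin.prod_univ_succ, Fin.consEquiv]

/-- A function on `ι → ℤ` which is a product over the coordinates is summable as soon as each
factor is nonnegative and summable. -/
theorem summable_prod_apply {ι : Type} [Fintype ι] (f : ι → ℤ → ℝ) (hf : ∀ i n, 0 ≤ f i n)
    (hs : ∀ i, Summable (f i)) : Summable fun n : ι → ℤ => ∏ i, f i (n i) := by
  let e := (Fintype.equivFin ι).symm
  rw [← (e.arrowCongr (Equiv.refl ℤ)).summable_iff]
  refine (summable_prod_fin_apply (fun i => f (e i)) (fun i => hf _) fun i => hs _).congr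
    fun n => ?_
  exact Fintype.prod_equiv e _ _ fun i => by simp

/-- The imaginary part of a point of the Siegel space dominates a multiple of the squared
Euclidean norm. -/
theorem Siegel.exists_mul_sum_sq_le {ι : Type} [Fintype ι] {τ : Matrix ι ι ℂ}
    (hτ : τ ∈ Siegel ι) :
    ∃ c : ℝ, 0 < c ∧ ∀ v : ι → ℝ, c * ∑ i, v i ^ 2 ≤ ∑ i, ∑ j, v i * (τ i j).im * v j := by
  obtain ⟨c, hc, hle⟩ := (isCompact_sphere (0 : EuclideanSpace ℝ ι) 1).exists_forall_le'
    (f := fun v => ∑ i, ∑ j, v i * (τ i j).im * v j) (a := 0) (by fun_prop) (by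
      intro v hv
      refine hτ.2 v fun h0 => ?_
      have : v = 0 := by ext i; exact congrFun h0 i
      simp [this] at hv)
  refine ⟨c, hc, fun v => ?_⟩
  by_cases h0 : v = 0
  · simp [h0]
  set w : EuclideanSpace ℝ ι := WithLp.toLp 2 v with hw
  have hw0 : 0 < ‖w‖ := by
    refine norm_pos_iff.2 fun h => h0 ?_
    ext i
    simpa [hw] using congrArg (fun u : EuclideanSpace ℝ ι => u i) h
  have h := hle (‖w‖⁻¹ • w) (by simp [norm_smul, hw0.ne'])
  have hsq : ∑ i, v i ^ 2 = ‖w‖ ^ 2 := by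
    rw [EuclideanSpace.norm_sq_eq]
    simp [hw]
  have hscale : ∑ i, ∑ j, (‖w‖⁻¹ • w) i * (τ i j).im * (‖w‖⁻¹ • w) j =
      (‖w‖ ^ 2)⁻¹ * ∑ i, ∑ j, v i * (τ i j).im * v j := by
    simp only [Finset.mul_sum, hw, PiLp.smul_apply, smul_eq_mul]
    refine Finset.sum_congr rfl fun i _ => Finset.sum_congr rfl fun j _ => ?_
    field_simp
  rw [hscale, inv_mul_eq_div, le_div_iff₀ (by positivity)] at h
  rwa [hsq]

/-- Summability over `ℤ` of a Gaussian with centre `0` or `-1/2`. -/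
theorem summable_exp_neg_mul_add_half_sq {c : ℝ} (hc : 0 < c) (e : ZMod 2) :
    Summable fun n : ℤ => Real.exp (-Real.pi * (c * ((n : ℝ) + (e.val : ℝ) / 2) ^ 2)) := by
  refine (summable_pow_mul_jacobiTheta₂_term_bound (c / 2) hc 0).of_nonneg_of_le
    (fun n => (Real.exp_pos _).le) fun n => ?_
  have he : (e.val : ℝ) ≤ 1 := by
    exact_mod_cast Nat.lt_succ_iff.1 (ZMod.val_lt e)
  have he0 : (0 : ℝ) ≤ e.val := by positivity
  rw [pow_zero, one_mul, Real.exp_le_exp]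
  have h1 : (n : ℝ) ^ 2 - |(n : ℝ)| ≤ ((n : ℝ) + (e.val : ℝ) / 2) ^ 2 := by
    have h2 : -|(n : ℝ)| ≤ n := neg_abs_le _
    nlinarith [abs_nonneg (n : ℝ), mul_le_mul_of_nonneg_left h2 he0,
      mul_le_mul_of_nonneg_right he (abs_nonneg (n : ℝ))]
  have h3 : c * (n : ℝ) ^ 2 - 2 * (c / 2) * |(n : ℝ)| ≤
      c * ((n : ℝ) + (e.val : ℝ) / 2) ^ 2 := by
    linarith [mul_le_mul_of_nonneg_left h1 hc.le]
  push_cast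
  nlinarith [Real.pi_pos, mul_le_mul_of_nonneg_left h3 Real.pi_pos.le]

/-- The general term of the series defining the theta constant. -/
def thetaTerm {ι : Type} [Fintype ι] (m : Char2 ι) (τ : Matrix ι ι ℂ) (n : ι → ℤ) : ℂ :=
  Complex.exp ((Real.pi : ℂ) * Complex.I *
    ((∑ i, ∑ j, ((n i : ℂ) + ((m.1 i).val : ℂ) / 2) * τ i j *
        ((n j : ℂ) + ((m.1 j).val : ℂ) / 2)) +
     2 * ∑ i, ((n i : ℂ) + ((m.1 i).val : ℂ) / 2) * (((m.2 i).val : ℂ) / 2)))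

theorem thetaConst_eq_tsum {ι : Type} [Fintype ι] (m : Char2 ι) (τ : Matrix ι ι ℂ) :
    thetaConst m τ = ∑' n, thetaTerm m τ n := by
  simp [thetaConst, thetaChar, theta, thetaTerm]

theorem norm_thetaTerm {ι : Type} [Fintype ι] (m : Char2 ι) (τ : Matrix ι ι ℂ) (n : ι → ℤ) :
    ‖thetaTerm m τ n‖ = Real.exp (-Real.pi * ∑ i, ∑ j, ((n i : ℝ) + ((m.1 i).val : ℝ) / 2) *
      (τ i j).im * ((n j : ℝ) + ((m.1 j).val : ℝ) / 2)) := by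
  set x : ι → ℝ := fun i => (n i : ℝ) + ((m.1 i).val : ℝ) / 2 with hx
  have hquad : (∑ i, ∑ j, (x i : ℂ) * τ i j * (x j : ℂ)).im =
      ∑ i, ∑ j, x i * (τ i j).im * x j := by
    simp [Complex.im_sum]
  have hlin : (2 * ∑ i, (x i : ℂ) * (((m.2 i).val : ℂ) / 2)).im = 0 := by
    have : (2 * ∑ i, (x i : ℂ) * (((m.2 i).val : ℂ) / 2)) =
        ((2 * ∑ i, x i * (((m.2 i).val : ℝ) / 2) : ℝ) : ℂ) := by push_cast; rfl
    rw [this, Complex.ofReal_im]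
  have hterm : thetaTerm m τ n = Complex.exp ((Real.pi : ℂ) * Complex.I *
      ((∑ i, ∑ j, (x i : ℂ) * τ i j * (x j : ℂ)) +
        2 * ∑ i, (x i : ℂ) * (((m.2 i).val : ℂ) / 2))) := by
    simp [thetaTerm, hx, -ZMod.natCast_val]
  rw [hterm, Complex.norm_exp, mul_assoc, Complex.re_ofReal_mul, Complex.I_mul_re,
    Complex.add_im, hquad, hlin]
  congr 1
  ring

theorem summable_norm_thetaTerm {ι : Type} [Fintype ι] (m : Char2 ι) {τ : Matrix ι ι ℂ}
    (hτ : τ ∈ Siegel ι) : Summable fun n => ‖thetaTerm m τ n‖ := by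
  obtain ⟨c, hc, hle⟩ := Siegel.exists_mul_sum_sq_le hτ
  refine (summable_prod_apply
    (fun i n => Real.exp (-Real.pi * (c * ((n : ℝ) + ((m.1 i).val : ℝ) / 2) ^ 2)))
    (fun i n => (Real.exp_pos _).le)
    fun i => summable_exp_neg_mul_add_half_sq hc (m.1 i)).of_nonneg_of_le
    (fun n => norm_nonneg _) fun n => ?_
  rw [norm_thetaTerm, ← Real.exp_sum, Real.exp_le_exp, ← Finset.mul_sum, ← Finset.mul_sum]
  exact mul_le_mul_of_nonpos_left (hle _) (by linarith [Real.pi_pos])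

/-- The linear equivalence splitting a characteristic for a block decomposition. -/
def charSumEquiv (α β : Type) : Char2 (α ⊕ β) ≃ₗ[ZMod 2] Char2 α × Char2 β :=
  ((LinearEquiv.sumArrowLequivProdArrow α β (ZMod 2) (ZMod 2)).prodCongr
    (LinearEquiv.sumArrowLequivProdArrow α β (ZMod 2) (ZMod 2))).trans
      (LinearEquiv.prodProdProdComm (ZMod 2) _ _ _ _)

/-- Theta constants are multiplicative on block-diagonal period matrices. -/
theorem thetaConst_fromBlocks {α β : Type} [Fintype α] [Fintype β] (m : Char2 (α ⊕ β))
    {τ₁ : Matrix α α ℂ} (hτ₁ : τ₁ ∈ Siegel α) {τ₂ : Matrix β β ℂ} (hτ₂ : τ₂ ∈ Siegel β) :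
    thetaConst m (Matrix.fromBlocks τ₁ 0 0 τ₂) =
      thetaConst (charSumEquiv α β m).1 τ₁ * thetaConst (charSumEquiv α β m).2 τ₂ := by
  simp only [thetaConst_eq_tsum]
  rw [tsum_mul_tsum_of_summable_norm (summable_norm_thetaTerm _ hτ₁)
    (summable_norm_thetaTerm _ hτ₂), ← (Equiv.sumArrowEquivProdArrow α β ℤ).tsum_eq]
  refine tsum_congr fun n => ?_
  rw [thetaTerm, thetaTerm, thetaTerm, ← Complex.exp_add]
  congr 1
  simp [charSumEquiv, Fintype.sum_sum_type]
  ring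

section SubspaceCounting

variable {K A B : Type*} [Field K] [AddCommGroup A] [Module K A] [AddCommGroup B] [Module K B]

/-- The number of surjective linear maps onto an `r`-dimensional space. -/
theorem card_surjective_linearMap [Fintype K] [Finite A] {r : ℕ}
    (hr : r ≤ Module.finrank K A) :
    Nat.card {f : A →ₗ[K] Module.Dual K (Fin r → K) // Function.Surjective f} =
      ∏ j ∈ Finset.range r, (Fintype.card K ^ Module.finrank K A - Fintype.card K ^ j) := by
  have : Finite (Module.Dual K A) := Module.finite_of_finite K
  rw [Finset.prod_range, ← Subspace.dual_finrank_eq (K := K) (V := A),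
    ← card_linearIndependent (by rwa [Subspace.dual_finrank_eq])]
  refine (Nat.card_congr (Equiv.subtypeEquiv
    (((Pi.basisFun K (Fin r)).constr K).trans LinearMap.lflip).toEquiv fun s => ?_)).symm
  have h : Function.Surjective (LinearMap.flip ((Pi.basisFun K (Fin r)).constr K s)) ↔
      Function.Injective ((Pi.basisFun K (Fin r)).constr K s) := by
    rw [← LinearMap.flip_injective_iff₁, LinearMap.flip_flip]
  have h2 : ((Pi.basisFun K (Fin r)).constr K s : (Fin r → K) →ₗ[K] Module.Dual K A) =
      Fintype.linearCombination K s := by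
    ext i
    simp [Module.Basis.constr_apply_fintype, Fintype.linearCombination_apply]
  rw [linearIndependent_iff_injective_fintypeLinearCombination, ← h2, ← h]
  rfl

/-- Linear maps with a prescribed kernel `V` onto a space of dimension `codim V` correspond to
surjective linear maps out of the quotient by `V`. -/
theorem card_linearMap_ker_eq {T : Type*} [AddCommGroup T] [Module K T]
    [FiniteDimensional K A] [FiniteDimensional K T] (V : Submodule K A)
    (hV : Module.finrank K (A ⧸ V) = Module.finrank K T) :
    Nat.card {F : A →ₗ[K] T // LinearMap.ker F = V} =
      Nat.card {G : (A ⧸ V) →ₗ[K] T // Function.Surjective G} := by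
  refine Nat.card_congr
    { toFun := fun F => ⟨V.liftQ F.1 F.2.ge, ?_⟩
      invFun := fun G => ⟨G.1 ∘ₗ V.mkQ, ?_⟩
      left_inv := fun F => Subtype.ext (Submodule.liftQ_mkQ _ _ _)
      right_inv := fun G => Subtype.ext (by ext; simp) }
  · rw [← LinearMap.injective_iff_surjective_of_finrank_eq_finrank hV, ← LinearMap.ker_eq_bot]
    exact Submodule.ker_liftQ_eq_bot _ _ _ F.2.le
  · rw [LinearMap.ker_comp, LinearMap.ker_eq_bot.2
      ((LinearMap.injective_iff_surjective_of_finrank_eq_finrank hV).2 G.2), ← LinearMap.ker,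
      Submodule.ker_mkQ]

/-- Both components of a linear map on a product are surjective exactly when the kernel is a
subdirect product of the right dimension. -/
theorem surjective_components_iff_ker {T : Type*} [AddCommGroup T] [Module K T]
    [FiniteDimensional K A] [FiniteDimensional K B] [FiniteDimensional K T] {i : ℕ}
    (hi : Module.finrank K T + i = Module.finrank K A + Module.finrank K B)
    (F : A × B →ₗ[K] T) :
    (Function.Surjective (F ∘ₗ LinearMap.inl K A B) ∧
      Function.Surjective (F ∘ₗ LinearMap.inr K A B)) ↔
    (Module.finrank K (LinearMap.ker F) = i ∧
      (LinearMap.ker F).map (LinearMap.fst K A B) = ⊤ ∧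
      (LinearMap.ker F).map (LinearMap.snd K A B) = ⊤) := by
  have hrank := F.finrank_range_add_finrank_ker
  rw [Module.finrank_prod] at hrank
  have hadd : ∀ a b, F (a, b) = F (a, 0) + F (0, b) := fun a b => by
    rw [← map_add]; simp
  constructor
  · rintro ⟨hf, hh⟩
    have hF : Function.Surjective F := fun y => by
      obtain ⟨a, ha⟩ := hf y
      exact ⟨_, ha⟩
    rw [LinearMap.range_eq_top.2 hF, finrank_top] at hrank
    refine ⟨by omega, ?_, ?_⟩
    · rw [eq_top_iff]
      intro a _
      obtain ⟨b, hb⟩ := hh (-F (a, 0))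
      refine ⟨(a, b), ?_, rfl⟩
      simp only [LinearMap.comp_apply, LinearMap.inr_apply] at hb
      simp [hadd a b, hb]
    · rw [eq_top_iff]
      intro b _
      obtain ⟨a, ha⟩ := hf (-F (0, b))
      refine ⟨(a, b), ?_, rfl⟩
      simp only [LinearMap.comp_apply, LinearMap.inl_apply] at ha
      simp [hadd a b, ha]
  · rintro ⟨hker, hfst, hsnd⟩
    have hF : Function.Surjective F := by
      rw [← LinearMap.range_eq_top]
      exact Submodule.eq_top_of_finrank_eq (by omega)
    constructor
    · intro y
      obtain ⟨⟨a, b⟩, rfl⟩ := hF y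
      obtain ⟨⟨a', b'⟩, h0, rfl⟩ : b ∈ (LinearMap.ker F).map (LinearMap.snd K A B) := by
        simp [hsnd]
      refine ⟨a - a', ?_⟩
      have h0' : F (a', b') = 0 := h0
      have : F ((a, b') - (a', b')) = F (a, b') := by rw [map_sub, h0', sub_zero]
      simpa using this
    · intro y
      obtain ⟨⟨a, b⟩, rfl⟩ := hF y
      obtain ⟨⟨a', b'⟩, h0, rfl⟩ : a ∈ (LinearMap.ker F).map (LinearMap.fst K A B) := by
        simp [hfst]
      refine ⟨b - b', ?_⟩
      have h0' : F (a', b') = 0 := h0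
      have : F ((a', b) - (a', b')) = F (a', b) := by rw [map_sub, h0', sub_zero]
      simpa using this

/-- The number of subdirect products of given dimension inside `A × B`. -/
theorem card_subdirect_mul [Fintype K] [Finite A] [Finite B] {r i : ℕ}
    (hA : r ≤ Module.finrank K A) (hB : r ≤ Module.finrank K B)
    (hi : r + i = Module.finrank K A + Module.finrank K B) :
    Nat.card {V : Submodule K (A × B) // Module.finrank K V = i ∧
      V.map (LinearMap.fst K A B) = ⊤ ∧ V.map (LinearMap.snd K A B) = ⊤} *
        ∏ j ∈ Finset.range r, (Fintype.card K ^ r - Fintype.card K ^ j) =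
    (∏ j ∈ Finset.range r, (Fintype.card K ^ Module.finrank K A - Fintype.card K ^ j)) *
      ∏ j ∈ Finset.range r, (Fintype.card K ^ Module.finrank K B - Fintype.card K ^ j) := by
  have hT : Module.finrank K (Module.Dual K (Fin r → K)) = r := by
    rw [Subspace.dual_finrank_eq, Module.finrank_fin_fun]
  have : Finite (Module.Dual K (Fin r → K)) := Module.finite_of_finite K
  have : Finite (A × B →ₗ[K] Module.Dual K (Fin r → K)) := Module.finite_of_finite K
  have : Fintype {V : Submodule K (A × B) // Module.finrank K V = i ∧
      V.map (LinearMap.fst K A B) = ⊤ ∧ V.map (LinearMap.snd K A B) = ⊤} := Fintype.ofFinite _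
  have hi' : Module.finrank K (Module.Dual K (Fin r → K)) + i =
      Module.finrank K A + Module.finrank K B := by rw [hT, hi]
  have hpairs : Nat.card {F : A × B →ₗ[K] Module.Dual K (Fin r → K) //
      Function.Surjective (F ∘ₗ LinearMap.inl K A B) ∧
        Function.Surjective (F ∘ₗ LinearMap.inr K A B)} =
      Nat.card {f : A →ₗ[K] Module.Dual K (Fin r → K) // Function.Surjective f} *
        Nat.card {f : B →ₗ[K] Module.Dual K (Fin r → K) // Function.Surjective f} := by
    rw [← Nat.card_prod]
    refine (Nat.card_congr ((Equiv.subtypeProdEquivProd).symm.trans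
      (Equiv.subtypeEquiv (LinearMap.coprodEquiv K).toEquiv fun p => ?_))).symm
    simp
  rw [← card_surjective_linearMap hA, ← card_surjective_linearMap hB, ← hpairs,
    ← Nat.card_congr (Equiv.sigmaSubtypeFiberEquivSubtype
      (q := fun V : Submodule K (A × B) => Module.finrank K V = i ∧
        V.map (LinearMap.fst K A B) = ⊤ ∧ V.map (LinearMap.snd K A B) = ⊤) LinearMap.ker
      (surjective_components_iff_ker hi')), Nat.card_sigma]
  have hfib : ∀ V : {V : Submodule K (A × B) // Module.finrank K V = i ∧
      V.map (LinearMap.fst K A B) = ⊤ ∧ V.map (LinearMap.snd K A B) = ⊤},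
      Nat.card {F : A × B →ₗ[K] Module.Dual K (Fin r → K) // LinearMap.ker F = V.1} =
        ∏ j ∈ Finset.range r, (Fintype.card K ^ r - Fintype.card K ^ j) := by
    intro V
    have : Finite ((A × B) ⧸ V.1) := Module.finite_of_finite K
    have hq := V.1.finrank_quotient_add_finrank
    rw [Module.finrank_prod, V.2.1] at hq
    have hq' : Module.finrank K ((A × B) ⧸ V.1) = r := by omega
    rw [card_linearMap_ker_eq V.1 (by rw [hq', hT]), card_surjective_linearMap hq'.ge, hq']
  simp [hfib]

/-- Subspaces of `A × B` with projections `A'` and `B'` are the subdirect products in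
`A' × B'`. -/
theorem card_submodule_map_eq (A' : Submodule K A) (B' : Submodule K B) (i : ℕ) :
    Nat.card {V : Submodule K (A × B) // Module.finrank K V = i ∧
      V.map (LinearMap.fst K A B) = A' ∧ V.map (LinearMap.snd K A B) = B'} =
    Nat.card {V : Submodule K (A' × B') // Module.finrank K V = i ∧
      V.map (LinearMap.fst K A' B') = ⊤ ∧ V.map (LinearMap.snd K A' B') = ⊤} := by
  let φ : A' × B' →ₗ[K] A × B := A'.subtype.prodMap B'.subtype
  have hφ : Function.Injective φ := A'.injective_subtype.prodMap B'.injective_subtype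
  have hiff : ∀ V : Submodule K (A' × B'), (Module.finrank K V = i ∧
      V.map (LinearMap.fst K A' B') = ⊤ ∧ V.map (LinearMap.snd K A' B') = ⊤) ↔
      (Module.finrank K (V.map φ) = i ∧ (V.map φ).map (LinearMap.fst K A B) = A' ∧
        (V.map φ).map (LinearMap.snd K A B) = B') := by
    intro V
    have h1 : (V.map φ).map (LinearMap.fst K A B) =
        (V.map (LinearMap.fst K A' B')).map A'.subtype := by
      rw [← Submodule.map_comp, ← Submodule.map_comp]; rfl
    have h2 : (V.map φ).map (LinearMap.snd K A B) =
        (V.map (LinearMap.snd K A' B')).map B'.subtype := by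
      rw [← Submodule.map_comp, ← Submodule.map_comp]; rfl
    have h3 : ∀ W : Submodule K A', W.map A'.subtype = A' ↔ W = ⊤ := fun W => by
      rw [← (Submodule.map_injective_of_injective A'.injective_subtype).eq_iff,
        Submodule.map_subtype_top]
    have h4 : ∀ W : Submodule K B', W.map B'.subtype = B' ↔ W = ⊤ := fun W => by
      rw [← (Submodule.map_injective_of_injective B'.injective_subtype).eq_iff,
        Submodule.map_subtype_top]
    rw [h1, h2, h3, h4, (Submodule.equivMapOfInjective φ hφ V).finrank_eq]
  symm
  refine Nat.card_congr (Equiv.ofBijective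
    (fun V => ⟨V.1.map φ, (hiff V.1).1 V.2⟩) ⟨fun V W h => ?_, fun V => ?_⟩)
  · exact Subtype.ext (Submodule.map_injective_of_injective hφ (congrArg Subtype.val h))
  · have hmap : (V.1.comap φ).map φ = V.1 := by
      rw [Submodule.map_comap_eq, inf_eq_right]
      rintro ⟨a, b⟩ hab
      have ha : a ∈ A' := V.2.2.1 ▸ Submodule.mem_map_of_mem (f := LinearMap.fst K A B) hab
      have hb : b ∈ B' := V.2.2.2 ▸ Submodule.mem_map_of_mem (f := LinearMap.snd K A B) hab
      exact ⟨(⟨a, ha⟩, ⟨b, hb⟩), rfl⟩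
    exact ⟨⟨V.1.comap φ, (hiff _).2 (by rw [hmap]; exact V.2)⟩, Subtype.ext hmap⟩

/-- The product over a subspace of a function factoring through a linear map. -/
theorem prod_comp_linearMap [Fintype K] [Finite A] (V : Submodule K A) (f : A →ₗ[K] B)
    [Fintype V] [Fintype (V.map f)] (φ : B → ℂ) :
    ∏ v : V, φ (f v) = (∏ b : V.map f, φ b) ^
      Fintype.card K ^ (Module.finrank K V - Module.finrank K (V.map f)) := by
  classical
  let p : V →ₗ[K] V.map f := f.submoduleMap V
  have hp : Function.Surjective p := f.submoduleMap_surjective V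
  have hrank := p.finrank_range_add_finrank_ker
  rw [LinearMap.range_eq_top.2 hp, finrank_top] at hrank
  have hker : Nat.card (LinearMap.ker p) =
      Fintype.card K ^ (Module.finrank K V - Module.finrank K (V.map f)) := by
    rw [← hrank, Nat.add_sub_cancel_left, Module.natCard_eq_pow_finrank (K := K),
      Nat.card_eq_fintype_card]
  have hfib : ∀ b, (Finset.univ.filter fun v => p v = b).card = Nat.card (LinearMap.ker p) := by
    intro b
    rw [AddMonoidHom.card_fiber_eq_of_mem_range p (hp b) ⟨0, map_zero p⟩,
      ← Fintype.card_subtype, ← Nat.card_eq_fintype_card]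
    rfl
  rw [← hker, ← Finset.prod_pow, ← Finset.prod_fiberwise Finset.univ p]
  refine Finset.prod_congr rfl fun b _ => ?_
  rw [← hfib b, ← Finset.prod_const]
  refine Finset.prod_congr rfl fun v hv => ?_
  rw [← (Finset.mem_filter.1 hv).2]
  rfl

end SubspaceCounting

section PformDecomposition

open scoped Classical

instance Submodule.fintypeOfFinite {M : Type} [AddCommGroup M] [Module (ZMod 2) M] [Finite M] :
    Fintype (Submodule (ZMod 2) M) :=
  Fintype.ofFinite _

/-- The summand of `Pform` attached to a subspace, with exponent `2 ^ (4 - dim)`. -/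
def subspaceTerm {ι : Type} [Fintype ι] (τ : Matrix ι ι ℂ) (V : Submodule (ZMod 2) (Char2 ι)) :
    ℂ :=
  letI := Fintype.ofFinite V
  (∏ v : V, thetaConst v.1 τ) ^ 2 ^ (4 - Module.finrank (ZMod 2) V)

/-- `Pform` as a sum over submodules. -/
theorem Pform_eq_sum_submodule (ι : Type) [Fintype ι] (i : ℕ) (τ : Matrix ι ι ℂ) :
    Pform ι i (2 ^ (4 - i)) τ = ∑ V : Submodule (ZMod 2) (Char2 ι),
      if Module.finrank (ZMod 2) V = i then subspaceTerm τ V else 0 := by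
  rw [Pform, ← Finset.sum_filter]
  symm
  refine Finset.sum_bij (fun V _ => (V : Set (Char2 ι)).toFinset) ?_ ?_ ?_ ?_
  · intro V hV
    simp only [Finset.mem_filter, Finset.mem_univ, true_and] at hV ⊢
    exact ⟨V, hV, by simp⟩
  · intro V _ W _ h
    exact SetLike.coe_injective (Set.toFinset_inj.1 h)
  · intro W hW
    simp only [Finset.mem_filter, Finset.mem_univ, true_and] at hW
    obtain ⟨V, hV, hWV⟩ := hW
    refine ⟨V, by simp [hV], ?_⟩
    ext x
    rw [Set.mem_toFinset, ← hWV, Finset.mem_coe]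
  · intro V hV
    simp only [Finset.mem_filter, Finset.mem_univ, true_and] at hV
    rw [subspaceTerm, hV]
    congr 1
    exact (@Finset.prod_subtype _ _ _ (· ∈ V) (Fintype.ofFinite V) _ (fun x => by simp)
      (thetaConst · τ)).symm

/-- On a block-diagonal period matrix the summands of `Pform` factor through the two
projections. -/
theorem subspaceTerm_fromBlocks {α β : Type} [Fintype α] [Fintype β]
    {τ₁ : Matrix α α ℂ} (hτ₁ : τ₁ ∈ Siegel α) {τ₂ : Matrix β β ℂ} (hτ₂ : τ₂ ∈ Siegel β)
    (V : Submodule (ZMod 2) (Char2 (α ⊕ β))) (hV : Module.finrank (ZMod 2) V ≤ 4) :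
    subspaceTerm (Matrix.fromBlocks τ₁ 0 0 τ₂) V =
      subspaceTerm τ₁ ((V.map (charSumEquiv α β).toLinearMap).map (LinearMap.fst _ _ _)) *
      subspaceTerm τ₂ ((V.map (charSumEquiv α β).toLinearMap).map (LinearMap.snd _ _ _)) := by
  let := Fintype.ofFinite V
  let := Fintype.ofFinite (V.map
    (LinearMap.fst (ZMod 2) (Char2 α) (Char2 β) ∘ₗ (charSumEquiv α β).toLinearMap))
  let := Fintype.ofFinite (V.map
    (LinearMap.snd (ZMod 2) (Char2 α) (Char2 β) ∘ₗ (charSumEquiv α β).toLinearMap))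
  have h1 := prod_comp_linearMap V
    (LinearMap.fst (ZMod 2) (Char2 α) (Char2 β) ∘ₗ (charSumEquiv α β).toLinearMap)
    (thetaConst · τ₁)
  have h2 := prod_comp_linearMap V
    (LinearMap.snd (ZMod 2) (Char2 α) (Char2 β) ∘ₗ (charSumEquiv α β).toLinearMap)
    (thetaConst · τ₂)
  have hd1 := Submodule.finrank_map_le
    (LinearMap.fst (ZMod 2) (Char2 α) (Char2 β) ∘ₗ (charSumEquiv α β).toLinearMap) V
  have hd2 := Submodule.finrank_map_le
    (LinearMap.snd (ZMod 2) (Char2 α) (Char2 β) ∘ₗ (charSumEquiv α β).toLinearMap) V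
  simp only [← Submodule.map_comp]
  simp only [LinearMap.comp_apply, LinearEquiv.coe_coe, LinearMap.fst_apply,
    LinearMap.snd_apply, ZMod.card] at h1 h2
  simp only [subspaceTerm, thetaConst_fromBlocks _ hτ₁ hτ₂, Finset.prod_mul_distrib, mul_pow]
  rw [h1, h2, ← pow_mul, ← pow_mul, ← pow_add, ← pow_add]
  congr 3 <;> omega

/-- The number of subspaces of dimension `i` of a product with prescribed projections. -/
theorem card_submodule_map_eq_Ncoeff {A B : Type} [AddCommGroup A] [Module (ZMod 2) A]
    [AddCommGroup B] [Module (ZMod 2) B] [Finite A] [Finite B] (A' : Submodule (ZMod 2) A)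
    (B' : Submodule (ZMod 2) B) (i : ℕ) :
    (Nat.card {V : Submodule (ZMod 2) (A × B) // Module.finrank (ZMod 2) V = i ∧
      V.map (LinearMap.fst (ZMod 2) A B) = A' ∧ V.map (LinearMap.snd (ZMod 2) A B) = B'} : ℚ) =
    if Module.finrank (ZMod 2) A' ≤ i ∧ Module.finrank (ZMod 2) B' ≤ i ∧
      i ≤ Module.finrank (ZMod 2) A' + Module.finrank (ZMod 2) B' then
        Ncoeff (Module.finrank (ZMod 2) A') (Module.finrank (ZMod 2) B') i else 0 := by
  rw [card_submodule_map_eq]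
  split_ifs with h
  · obtain ⟨hA, hB, hAB⟩ := h
    have hcard := card_subdirect_mul (K := ZMod 2) (A := A') (B := B')
      (r := Module.finrank (ZMod 2) A' + Module.finrank (ZMod 2) B' - i) (i := i)
      (by omega) (by omega) (by omega)
    rw [ZMod.card] at hcard
    have hcast : ∀ {d r : ℕ}, r ≤ d →
        ((∏ j ∈ Finset.range r, (2 ^ d - 2 ^ j) : ℕ) : ℚ) =
          ∏ j ∈ Finset.range r, ((2 : ℚ) ^ d - 2 ^ j) := by
      intro d r hr
      rw [Nat.cast_prod]
      refine Finset.prod_congr rfl fun j hj => ?_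
      rw [Nat.cast_sub (Nat.pow_le_pow_right two_pos
        ((Finset.mem_range.1 hj).le.trans hr))]
      simp
    have hne : ∀ r : ℕ, ∏ j ∈ Finset.range r, ((2 : ℚ) ^ r - 2 ^ j) ≠ 0 := fun r =>
      Finset.prod_ne_zero_iff.2 fun j hj => sub_ne_zero.2
        (pow_lt_pow_right₀ one_lt_two (Finset.mem_range.1 hj)).ne'
    have hq := congrArg (Nat.cast : ℕ → ℚ) hcard
    rw [Nat.cast_mul, Nat.cast_mul, hcast le_rfl, hcast (by omega), hcast (by omega)] at hq
    rw [Ncoeff, Finset.prod_div_distrib, Finset.prod_mul_distrib, eq_div_iff (hne _), hq]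
  · rw [Nat.cast_eq_zero, Nat.card_eq_zero]
    left
    refine ⟨fun ⟨V, hV, h1, h2⟩ => h ?_⟩
    have hd1 := Submodule.finrank_map_le (LinearMap.fst (ZMod 2) A' B') V
    have hd2 := Submodule.finrank_map_le (LinearMap.snd (ZMod 2) A' B') V
    rw [h1, finrank_top] at hd1
    rw [h2, finrank_top] at hd2
    have hd3 := V.finrank_le
    rw [Module.finrank_prod] at hd3
    omega

/-- Rearrangement of a double sum of products of sums over level sets. -/
theorem sum_sum_mul_sum_ite_eq {S T : Type*} [Fintype S] [Fintype T] (R : Finset ℕ)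
    (d : S → ℕ) (e : T → ℕ) (f : S → ℂ) (h : T → ℂ) (c : ℕ → ℕ → ℂ) :
    ∑ n ∈ R, ∑ m ∈ R, c n m * (∑ s, if d s = n then f s else 0) *
      (∑ t, if e t = m then h t else 0) =
    ∑ s, ∑ t, if d s ∈ R ∧ e t ∈ R then c (d s) (e t) * (f s * h t) else 0 := by
  have hterm : ∀ n m, c n m * (∑ s, if d s = n then f s else 0) *
      (∑ t, if e t = m then h t else 0) =
      ∑ s, ∑ t, if d s = n then if e t = m then c n m * (f s * h t) else 0 else 0 := by
    intro n m
    rw [mul_assoc, Finset.sum_mul_sum, Finset.mul_sum]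
    refine Finset.sum_congr rfl fun s _ => ?_
    rw [Finset.mul_sum]
    refine Finset.sum_congr rfl fun t _ => ?_
    split_ifs <;> simp
  simp only [hterm]
  simp only [Finset.sum_comm (s := R) (t := (Finset.univ : Finset S)),
    Finset.sum_comm (s := R) (t := (Finset.univ : Finset T))]
  refine Finset.sum_congr rfl fun s _ => Finset.sum_congr rfl fun t _ => ?_
  by_cases hs : d s ∈ R <;> by_cases ht : e t ∈ R <;> simp [hs, ht]

end PformDecomposition

/-- The factorization of `P_{i,2^{4−i}}^g` on block-diagonal period matrices. -/
theorem Pform_factorization (g k i : ℕ) (hg : 2 ≤ g) (hk : 1 ≤ k) (hk' : k ≤ g - 1)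
    (hi : i ≤ 4)
    (τ₁ : Matrix (Fin k) (Fin k) ℂ) (hτ₁ : τ₁ ∈ Siegel (Fin k))
    (τ₂ : Matrix (Fin (g - k)) (Fin (g - k)) ℂ) (hτ₂ : τ₂ ∈ Siegel (Fin (g - k))) :
    Pform (Fin k ⊕ Fin (g - k)) i (2 ^ (4 - i)) (Matrix.fromBlocks τ₁ 0 0 τ₂) =
      ∑ n ∈ Finset.range (i + 1), ∑ m ∈ Finset.range (i + 1),
        if i ≤ n + m then
          (Ncoeff n m i : ℂ) * Pform (Fin k) n (2 ^ (4 - n)) τ₁ *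
            Pform (Fin (g - k)) m (2 ^ (4 - m)) τ₂
        else 0 := by
  classical
  simp only [Pform_eq_sum_submodule]
  have hR : ∀ n m : ℕ, ∀ x y : ℂ, (if i ≤ n + m then (Ncoeff n m i : ℂ) * x * y else 0) =
      (if i ≤ n + m then (Ncoeff n m i : ℂ) else 0) * x * y := by
    intro n m x y
    split_ifs <;> simp
  simp only [hR]
  rw [sum_sum_mul_sum_ite_eq]
  let e := charSumEquiv (Fin k) (Fin (g - k))
  have hL : ∀ V : Submodule (ZMod 2) (Char2 (Fin k ⊕ Fin (g - k))),
      (if Module.finrank (ZMod 2) V = i then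
        subspaceTerm (Matrix.fromBlocks τ₁ 0 0 τ₂) V else 0) =
      (fun W : Submodule (ZMod 2) (Char2 (Fin k) × Char2 (Fin (g - k))) =>
        if Module.finrank (ZMod 2) W = i then subspaceTerm τ₁ (W.map (LinearMap.fst _ _ _)) *
          subspaceTerm τ₂ (W.map (LinearMap.snd _ _ _)) else 0)
        (Submodule.orderIsoMapComap e V) := by
    intro V
    have hf : Module.finrank (ZMod 2) (V.map e.toLinearMap) = Module.finrank (ZMod 2) V :=
      LinearEquiv.finrank_map_eq e V
    change _ = if Module.finrank (ZMod 2) (V.map e.toLinearMap) = i then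
      subspaceTerm τ₁ ((V.map e.toLinearMap).map (LinearMap.fst _ _ _)) *
      subspaceTerm τ₂ ((V.map e.toLinearMap).map (LinearMap.snd _ _ _)) else 0
    rw [hf]
    split_ifs with h
    · exact subspaceTerm_fromBlocks hτ₁ hτ₂ V (h.trans_le hi)
    · rfl
  rw [Fintype.sum_equiv (Submodule.orderIsoMapComap e).toEquiv _
    (fun W : Submodule (ZMod 2) (Char2 (Fin k) × Char2 (Fin (g - k))) =>
        if Module.finrank (ZMod 2) W = i then subspaceTerm τ₁ (W.map (LinearMap.fst _ _ _)) *
          subspaceTerm τ₂ (W.map (LinearMap.snd _ _ _)) else 0) hL, ← Finset.sum_filter,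
    ← Finset.sum_fiberwise _ fun W => W.map (LinearMap.fst _ _ _)]
  refine Finset.sum_congr rfl fun A _ => ?_
  rw [← Finset.sum_fiberwise _ fun W => W.map (LinearMap.snd _ _ _)]
  refine Finset.sum_congr rfl fun B _ => ?_
  rw [Finset.filter_filter, Finset.filter_filter,
    Finset.sum_congr (g := fun _ => subspaceTerm τ₁ A * subspaceTerm τ₂ B) rfl (by
      intro W hW
      obtain ⟨-, -, rfl, rfl⟩ := Finset.mem_filter.1 hW
      rfl), Finset.sum_const, nsmul_eq_mul]
  have hN := card_submodule_map_eq_Ncoeff A B i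
  rw [Nat.card_eq_fintype_card, Fintype.card_subtype] at hN
  rw [← Rat.cast_natCast, hN]
  simp only [Finset.mem_range, Nat.lt_succ_iff]
  split_ifs <;> first | (exfalso; omega) | simp
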